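/- Let K ⊆ ℝ² be a convex body and let x be a point on the boundary of K. If X_1 and X_2 are independent uniformly random points in K, then E(area(conv{x, X_1, X_2})) / area(K) ≥ 8/(9π²). -/

import Mathlib

open MeasureTheory

/-- A convex body in `ℝ²`: a compact convex set with nonempty interior. -/
def IsConvexBody (K : Set (EuclideanSpace ℝ (Fin 2))) : Prop :=
  IsCompact K ∧ Convex ℝ K ∧ (interior K).Nonempty

open Set Filter Topology in
theorem map_measureReal_Iic_eq_restrict_volume (ν : Measure ℝ) [IsFiniteMeasure ν] [NullSingletonClass ν] :
    ν.map (fun s ↦ ν.real (Iic s)) = volume.restrict (Icc 0 (ν.real univ)) := by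
  have hmono : Monotone fun s ↦ ν.real (Iic s) := fun a b hab ↦
    measureReal_mono (Iic_subset_Iic.2 hab)
  have htop : Tendsto (fun s ↦ ν.real (Iic s)) atTop (𝓝 (ν.real univ)) :=
    (ENNReal.tendsto_toReal (measure_ne_top _ _)).comp (tendsto_measure_Iic_atTop ν)
  have hbot : Tendsto (fun s ↦ ν.real (Iic s)) atBot (𝓝 0) := by
    have h : Tendsto (fun s ↦ ν (Iic s)) atBot (𝓝 (ν (⋂ s : ℝ, Iic s))) :=
      tendsto_measure_iInter_atBot (fun s ↦ measurableSet_Iic.nullMeasurableSet)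
        (fun a b hab ↦ Iic_subset_Iic.2 hab) ⟨0, measure_ne_top _ _⟩
    have he : (⋂ s : ℝ, Iic s) = ∅ :=
      eq_empty_of_forall_notMem fun s hs ↦ by
        have := mem_iInter.1 hs (s - 1)
        rw [mem_Iic] at this
        linarith
    rw [he, measure_empty] at h
    exact (ENNReal.tendsto_toReal ENNReal.zero_ne_top).comp h
  have hcont : Continuous fun s ↦ ν.real (Iic s) := by
    have hG : (fun s ↦ ν.real (Iic s)) = fun s ↦ ∫ t, (Iic s).indicator 1 t ∂ν := by
      ext s
      rw [integral_indicator_one measurableSet_Iic]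
    rw [hG]
    refine continuous_iff_continuousAt.2 fun s₀ ↦ continuousAt_of_dominated (bound := fun _ ↦ 1)
      (Eventually.of_forall fun s ↦
        (measurable_one.indicator measurableSet_Iic).aestronglyMeasurable)
      (Eventually.of_forall fun s ↦ Eventually.of_forall fun t ↦ ?_) (integrable_const 1) ?_
    · by_cases h : t ∈ Iic s <;> simp [h]
    · have hne : ∀ᵐ t ∂ν, t ≠ s₀ := by simp [ae_iff]
      filter_upwards [hne] with t ht
      rcases lt_or_gt_of_ne ht with h | h
      · refine (continuousAt_const (y := (1 : ℝ))).congr ?_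
        filter_upwards [lt_mem_nhds h] with s hs
        simp [hs.le]
      · refine (continuousAt_const (y := (0 : ℝ))).congr ?_
        filter_upwards [gt_mem_nhds h] with s hs
        simp [not_le.2 hs]
  refine Measure.ext_of_Iic _ _ fun c ↦ ?_
  rw [Measure.map_apply hcont.measurable measurableSet_Iic, Measure.restrict_apply measurableSet_Iic]
  have hI : Iic c ∩ Icc 0 (ν.real univ) = Icc 0 (min c (ν.real univ)) := by
    ext y; simp; tauto
  rw [hI, Real.volume_Icc, sub_zero]
  rcases lt_or_ge c (ν.real univ) with hc | hc
  · rw [min_eq_left hc.le]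
    by_cases hne : ((fun s ↦ ν.real (Iic s)) ⁻¹' Iic c).Nonempty
    · obtain ⟨b, hb⟩ := (htop.eventually (lt_mem_nhds hc)).exists
      have hbdd : BddAbove ((fun s ↦ ν.real (Iic s)) ⁻¹' Iic c) :=
        ⟨b, fun s hs ↦ le_of_not_gt fun h ↦ absurd (hmono h.le) (not_le.2 (lt_of_le_of_lt hs hb))⟩
      have hclosed : IsClosed ((fun s ↦ ν.real (Iic s)) ⁻¹' Iic c) :=
        isClosed_Iic.preimage hcont
      set s₀ := sSup ((fun s ↦ ν.real (Iic s)) ⁻¹' Iic c) with hs₀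
      have hmem : ν.real (Iic s₀) ≤ c := hclosed.csSup_mem hne hbdd
      have heq : (fun s ↦ ν.real (Iic s)) ⁻¹' Iic c = Iic s₀ := by
        ext s
        exact ⟨fun hs ↦ le_csSup hbdd hs, fun hs ↦ (hmono hs).trans hmem⟩
      have hval : ν.real (Iic s₀) = c := by
        refine le_antisymm hmem (ge_of_tendsto (hcont.continuousWithinAt (s := Ioi s₀)) ?_)
        filter_upwards [self_mem_nhdsWithin] with s hs
        by_contra h
        exact absurd (le_csSup hbdd (show s ∈ _ from (not_le.1 h).le)) (not_le.2 hs)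
      rw [heq, ← hval, ofReal_measureReal]
    · rw [not_nonempty_iff_eq_empty.1 hne, measure_empty, ENNReal.ofReal_of_nonpos]
      by_contra h
      obtain ⟨b, hb⟩ := (hbot.eventually (gt_mem_nhds (not_le.1 h))).exists
      exact hne ⟨b, hb.le⟩
  · rw [min_eq_right hc, ofReal_measureReal]
    congr 1
    exact eq_univ_of_forall fun s ↦ (measureReal_mono (subset_univ _)).trans hc

open Set in
theorem integral_inv_sqrt_mul_sub {M : ℝ} (hM : 0 < M) :
    IntegrableOn (fun p ↦ (√(p * (M - p)))⁻¹) (Ioc 0 M) ∧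
      ∫ p in (0)..M, (√(p * (M - p)))⁻¹ = Real.pi := by
  have hcont : Continuous fun p : ℝ ↦ Real.arcsin (2 * p / M - 1) := by
    fun_prop
  have hderiv : ∀ p ∈ Ioo 0 M, HasDerivAt (fun p : ℝ ↦ Real.arcsin (2 * p / M - 1))
      ((√(p * (M - p)))⁻¹) p := by
    intro p hp
    have h0 : 0 < p := hp.1
    have h1 : 0 < M - p := sub_pos.2 hp.2
    have h : HasDerivAt (fun p : ℝ ↦ 2 * p / M - 1) (2 / M) p := by
      simpa using (((hasDerivAt_id p).const_mul 2).div_const M).sub_const 1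
    have h2 := (Real.hasDerivAt_arcsin (x := 2 * p / M - 1)
      (by have : 0 < 2 * p / M := by positivity
          linarith)
      (by have : 2 * p / M < 2 := by rw [div_lt_iff₀ hM]; linarith
          linarith)).comp p h
    refine h2.congr_deriv ?_
    have : 1 - (2 * p / M - 1) ^ 2 = p * (M - p) * (2 / M) ^ 2 := by field_simp; ring
    rw [this, Real.sqrt_mul (by positivity), Real.sqrt_sq (by positivity)]
    have : 0 < √(p * (M - p)) := Real.sqrt_pos.2 (by positivity)
    field_simp
  have hint : IntegrableOn (fun p ↦ (√(p * (M - p)))⁻¹) (Ioc 0 M) :=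
    intervalIntegral.integrableOn_deriv_of_nonneg hcont.continuousOn hderiv
      fun p _ ↦ by positivity
  refine ⟨hint, ?_⟩
  rw [intervalIntegral.integral_eq_sub_of_hasDerivAt_of_le hM.le hcont.continuousOn hderiv
    ((intervalIntegrable_iff_integrableOn_Ioc_of_le hM.le).2 hint)]
  have : 2 * M / M - 1 = 1 := by field_simp; norm_num
  rw [this]
  simp

open Set in
theorem lintegral_rpow_neg_half_measure_Iic_mul_measure_Ioi_le (ν : Measure ℝ) [IsFiniteMeasure ν]
    [NullSingletonClass ν] :
    ∫⁻ s, (ν (Iic s) * ν (Ioi s)) ^ (-(1 / 2) : ℝ) ∂ν ≤ ENNReal.ofReal Real.pi := by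
  rcases eq_or_ne ν 0 with rfl | h0
  · simp
  have hM : 0 < ν.real univ := by
    rw [measureReal_def]
    exact ENNReal.toReal_pos (by simpa using h0) (measure_ne_top _ _)
  have hmono : Monotone fun s ↦ ν.real (Iic s) := fun a b hab ↦
    measureReal_mono (Iic_subset_Iic.2 hab)
  have hrw : ∀ s, (ν (Iic s) * ν (Ioi s)) ^ (-(1 / 2) : ℝ) =
      (fun p : ℝ ↦ (ENNReal.ofReal (p * (ν.real univ - p))) ^ (-(1 / 2) : ℝ)) (ν.real (Iic s)) := by
    intro s
    have : ν.real univ - ν.real (Iic s) = ν.real (Ioi s) := by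
      rw [← compl_Iic, measureReal_compl measurableSet_Iic]
    simp only
    rw [this, ENNReal.ofReal_mul measureReal_nonneg, ofReal_measureReal, ofReal_measureReal]
  simp_rw [hrw]
  rw [← lintegral_map (f := fun p : ℝ ↦ (ENNReal.ofReal (p * (ν.real univ - p))) ^ (-(1 / 2) : ℝ))
    (by fun_prop) hmono.measurable, map_measureReal_Iic_eq_restrict_volume,
    restrict_Ioo_eq_restrict_Icc.symm]
  obtain ⟨hint, hval⟩ := integral_inv_sqrt_mul_sub hM
  rw [← hval, intervalIntegral.integral_of_le hM.le, ofReal_integral_eq_lintegral_ofReal hint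
    (Filter.Eventually.of_forall fun p ↦ by positivity), ← restrict_Ioo_eq_restrict_Ioc]
  refine setLIntegral_mono' measurableSet_Ioo fun p hp ↦ ?_
  have : 0 < p * (ν.real univ - p) := mul_pos hp.1 (sub_pos.2 hp.2)
  rw [ENNReal.ofReal_rpow_of_pos this, Real.rpow_neg this.le, Real.sqrt_eq_rpow]

open Set in
theorem lintegral_rpow_two_thirds_le {g : ℝ → ENNReal} (hg : Measurable g)
    (hfin : ∫⁻ s, g s ≠ ⊤) :
    (∫⁻ s, g s ^ (2 / 3 : ℝ)) ^ 3 ≤ ENNReal.ofReal Real.pi ^ 2 *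
      ∫⁻ s, volume.withDensity g (Iic s) * volume.withDensity g (Ioi s) := by
  set ν := volume.withDensity g
  have : IsFiniteMeasure ν := isFiniteMeasure_withDensity hfin
  have hl := lintegral_rpow_neg_half_measure_Iic_mul_measure_Ioi_le ν
  have hm1 : Measurable fun s ↦ ν (Iic s) :=
    Monotone.measurable fun a b hab ↦ measure_mono (Iic_subset_Iic.2 hab)
  have hm2 : Measurable fun s ↦ ν (Ioi s) :=
    Antitone.measurable fun a b hab ↦ measure_mono (Ioi_subset_Ioi hab)
  set q : ℝ → ENNReal := fun s ↦ ν (Iic s) * ν (Ioi s) with hq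
  have hqm : Measurable q := hm1.mul hm2
  have hqtop : ∀ s, q s ≠ ⊤ := fun s ↦
    ENNReal.mul_ne_top (measure_ne_top _ _) (measure_ne_top _ _)
  have hae : ∀ᵐ s ∂ν, q s ≠ 0 := by
    have := ae_lt_top (hqm.pow_const (-(1 / 2) : ℝ)) (ne_top_of_le_ne_top ENNReal.ofReal_ne_top hl)
    filter_upwards [this] with s hs h0
    rw [h0, ENNReal.zero_rpow_of_neg (by norm_num)] at hs
    exact lt_irrefl _ hs
  rw [ae_withDensity_iff hg] at hae
  rw [lintegral_withDensity_eq_lintegral_mul _ hg (hqm.pow_const _)] at hl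
  have hle : ∀ᵐ s, g s ^ (2 / 3 : ℝ) ≤
      q s ^ (1 / 3 : ℝ) * (g s * q s ^ (-(1 / 2) : ℝ)) ^ (2 / 3 : ℝ) := by
    filter_upwards [hae] with s hs
    rcases eq_or_ne (g s) 0 with h0 | h0
    · simp [h0]
    have h1 := hs h0
    rw [ENNReal.mul_rpow_of_nonneg (g s) _ (by norm_num), ← ENNReal.rpow_mul, mul_left_comm,
      ← ENNReal.rpow_add _ _ h1 (hqtop s)]
    norm_num
  have hH := ENNReal.lintegral_mul_le_Lp_mul_Lq volume (p := 3) (q := 3 / 2)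
    (Real.holderConjugate_iff.2 (by norm_num)) (f := fun s ↦ q s ^ (1 / 3 : ℝ))
    (g := fun s ↦ (g s * q s ^ (-(1 / 2) : ℝ)) ^ (2 / 3 : ℝ)) (hqm.pow_const _).aemeasurable
    ((hg.mul (hqm.pow_const _)).pow_const _).aemeasurable
  simp only [← ENNReal.rpow_mul, Pi.mul_apply] at hH hl
  norm_num at hH hl
  calc (∫⁻ s, g s ^ (2 / 3 : ℝ)) ^ 3
      ≤ ((∫⁻ s, q s) ^ (1 / 3 : ℝ) * ENNReal.ofReal Real.pi ^ (2 / 3 : ℝ)) ^ 3 := by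
        gcongr
        refine (lintegral_mono_ae hle).trans (hH.trans ?_)
        gcongr
    _ = _ := by
        rw [mul_pow, ← ENNReal.rpow_natCast, ← ENNReal.rpow_natCast, ← ENNReal.rpow_mul,
          ← ENNReal.rpow_mul, mul_comm, ← ENNReal.rpow_natCast]
        norm_num

open Set in
theorem lintegral_lintegral_abs_sub (ν : Measure ℝ) [SFinite ν] :
    ∫⁻ s, ∫⁻ t, ENNReal.ofReal |s - t| ∂ν ∂ν = 2 * ∫⁻ r, ν (Iic r) * ν (Ioi r) := by
  have hsplit : ∀ s t : ℝ, ENNReal.ofReal |s - t| =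
      ∫⁻ r, (Iic r).indicator 1 s * (Ioi r).indicator 1 t +
        (Ioi r).indicator 1 s * (Iic r).indicator 1 t := by
    intro s t
    have h : ∀ r : ℝ, (Iic r).indicator (1 : ℝ → ENNReal) s * (Ioi r).indicator 1 t +
        (Ioi r).indicator 1 s * (Iic r).indicator 1 t =
        (Ico (min s t) (max s t)).indicator 1 r := by
      intro r
      simp only [indicator_apply, mem_Iic, mem_Ioi, mem_Ico, Pi.one_apply, min_le_iff, lt_max_iff]
      rcases le_or_gt s r with h1 | h1 <;> rcases le_or_gt t r with h2 | h2 <;>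
        simp [*, not_le.2, not_lt.2]
    simp_rw [h]
    rw [lintegral_indicator_one measurableSet_Ico, Real.volume_Ico, max_sub_min_eq_abs, abs_sub_comm]
  have hI : Measurable fun p : ℝ × ℝ ↦ (Iic p.2).indicator (1 : ℝ → ENNReal) p.1 :=
    (measurable_one.indicator (measurableSet_le measurable_fst measurable_snd) :
      Measurable ({p : ℝ × ℝ | p.1 ≤ p.2}.indicator (1 : ℝ × ℝ → ENNReal)))
  have hJ : Measurable fun p : ℝ × ℝ ↦ (Ioi p.2).indicator (1 : ℝ → ENNReal) p.1 :=
    (measurable_one.indicator (measurableSet_lt measurable_snd measurable_fst) :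
      Measurable ({p : ℝ × ℝ | p.2 < p.1}.indicator (1 : ℝ × ℝ → ENNReal)))
  have hI' : ∀ s, Measurable fun r ↦ (Iic r).indicator (1 : ℝ → ENNReal) s := fun s ↦
    hI.comp (measurable_const.prodMk measurable_id)
  have hJ' : ∀ s, Measurable fun r ↦ (Ioi r).indicator (1 : ℝ → ENNReal) s := fun s ↦
    hJ.comp (measurable_const.prodMk measurable_id)
  have hm1 : Measurable fun s ↦ ν (Iic s) :=
    Monotone.measurable fun a b hab ↦ measure_mono (Iic_subset_Iic.2 hab)
  have hm2 : Measurable fun s ↦ ν (Ioi s) :=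
    Antitone.measurable fun a b hab ↦ measure_mono (Ioi_subset_Ioi hab)
  have hinner : ∀ s, ∫⁻ t, ENNReal.ofReal |s - t| ∂ν =
      ∫⁻ r, (Iic r).indicator 1 s * ν (Ioi r) + (Ioi r).indicator 1 s * ν (Iic r) := by
    intro s
    simp_rw [hsplit]
    rw [lintegral_lintegral_swap]
    · refine lintegral_congr fun r ↦ ?_
      rw [lintegral_add_left ((measurable_one.indicator measurableSet_Ioi).const_mul _),
        lintegral_const_mul _ (measurable_one.indicator measurableSet_Ioi),
        lintegral_const_mul _ (measurable_one.indicator measurableSet_Iic),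
        lintegral_indicator_one measurableSet_Ioi, lintegral_indicator_one measurableSet_Iic]
    · exact ((((hI' s).comp measurable_snd).mul hJ).add
        (((hJ' s).comp measurable_snd).mul hI)).aemeasurable
  simp_rw [hinner]
  rw [lintegral_lintegral_swap, ← lintegral_const_mul _
    (show Measurable fun r ↦ ν (Iic r) * ν (Ioi r) from hm1.mul hm2)]
  · refine lintegral_congr fun r ↦ ?_
    rw [lintegral_add_left ((measurable_one.indicator measurableSet_Iic).mul_const _),
      lintegral_mul_const _ (measurable_one.indicator measurableSet_Ioi),
      lintegral_mul_const _ (measurable_one.indicator measurableSet_Iic),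
      lintegral_indicator_one measurableSet_Ioi, lintegral_indicator_one measurableSet_Iic]
    ring
  · exact ((hI.mul (hm2.comp measurable_snd)).add
      (hJ.mul (hm1.comp measurable_snd))).aemeasurable

open Set in
theorem setLIntegral_snd_pos_eq {F : ℝ × ℝ → ENNReal} (hF : Measurable F) :
    ∫⁻ z in {z : ℝ × ℝ | 0 < z.2}, F z =
      ∫⁻ t : ℝ, ∫⁻ b in Ioi (0 : ℝ), ENNReal.ofReal b * F (t * b, b) := by
  have hset : {z : ℝ × ℝ | 0 < z.2} = univ ×ˢ Ioi 0 := by ext; simp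
  rw [hset, Measure.volume_eq_prod, ← Measure.prod_restrict, Measure.restrict_univ,
    lintegral_prod_symm' _ hF]
  symm
  rw [lintegral_lintegral_swap]
  symm
  · refine setLIntegral_congr_fun measurableSet_Ioi fun b hb ↦ ?_
    have hb : 0 < b := hb
    have hFb : Measurable fun a ↦ F (a, b) := hF.comp (measurable_id.prodMk measurable_const)
    rw [lintegral_const_mul _
      (show Measurable fun a ↦ F (a * b, b) from hFb.comp (measurable_id.mul_const b))]
    nth_rewrite 1 [← Real.smul_map_volume_mul_right hb.ne']
    rw [lintegral_smul_measure, lintegral_map hFb (by fun_prop), abs_of_pos hb]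
    rfl
  · refine Measurable.aemeasurable ?_
    have : Measurable fun p : ℝ × ℝ ↦ F (p.1 * p.2, p.2) := hF.comp (by fun_prop)
    exact (ENNReal.measurable_ofReal.comp measurable_snd).mul this

open Set in
theorem setLIntegral_id_pow_three_le {T : Set ℝ} (hT : MeasurableSet T) (hpos : T ⊆ Ioi 0) :
    8 * (∫⁻ b in T, ENNReal.ofReal b) ^ 3 ≤ 9 * (∫⁻ b in T, ENNReal.ofReal (b ^ 2)) ^ 2 := by
  set m := ∫⁻ b in T, ENNReal.ofReal b with hm
  set g := ∫⁻ b in T, ENNReal.ofReal (b ^ 2) with hg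
  rcases eq_or_ne g ⊤ with htop | htop
  · simp [htop]
  have key : ∀ r : ℝ, 0 ≤ r → ENNReal.ofReal r * m ≤ g + ENNReal.ofReal (r ^ 3 / 6) := by
    intro r hr
    have hI : ∫⁻ b in Ioc 0 r, ENNReal.ofReal ((r - b) * b) = ENNReal.ofReal (r ^ 3 / 6) := by
      rw [← ofReal_integral_eq_lintegral_ofReal
        (Continuous.integrableOn_Ioc (by fun_prop)), ← intervalIntegral.integral_of_le hr]
      · have : ∀ b : ℝ, (r - b) * b = r * b - b ^ 2 := fun b ↦ by ring
        simp_rw [this]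
        rw [intervalIntegral.integral_sub (Continuous.intervalIntegrable (by fun_prop) _ _)
          (Continuous.intervalIntegrable (by fun_prop) _ _),
          intervalIntegral.integral_const_mul, integral_id, integral_pow]
        congr 1
        norm_num
        ring
      · exact (ae_restrict_iff' measurableSet_Ioc).2 <| Filter.Eventually.of_forall fun b hb ↦
          mul_nonneg (sub_nonneg.2 hb.2) hb.1.le
    have hM1 : Measurable fun b : ℝ ↦ ENNReal.ofReal b := ENNReal.measurable_ofReal
    have hM2 : Measurable fun b : ℝ ↦ ENNReal.ofReal (b ^ 2) := by fun_prop
    rw [← hI, hm, hg, ← lintegral_const_mul _ hM1, ← lintegral_indicator hT,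
      ← lintegral_indicator hT, ← lintegral_indicator measurableSet_Ioc,
      ← lintegral_add_left (hM2.indicator hT)]
    refine lintegral_mono fun b ↦ ?_
    by_cases hb : b ∈ T
    · have hb0 : 0 < b := hpos hb
      rw [indicator_of_mem hb, indicator_of_mem hb, ← ENNReal.ofReal_mul hr]
      by_cases hbr : b ≤ r
      · rw [indicator_of_mem (show b ∈ Ioc 0 r from ⟨hb0, hbr⟩),
          ← ENNReal.ofReal_add (by positivity) (mul_nonneg (sub_nonneg.2 hbr) hb0.le)]
        exact ENNReal.ofReal_le_ofReal (by nlinarith)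
      · exact le_add_right (ENNReal.ofReal_le_ofReal (by nlinarith [not_le.1 hbr]))
    · simp [hb]
  have hmtop : m ≠ ⊤ := by
    refine ne_top_of_le_ne_top (ENNReal.add_ne_top.2 ⟨htop, ENNReal.ofReal_ne_top⟩)
      (le_trans ?_ (key 1 zero_le_one))
    simp
  obtain ⟨x, hx0, hx⟩ : ∃ x : ℝ, 0 ≤ x ∧ m = ENNReal.ofReal x :=
    ⟨m.toReal, ENNReal.toReal_nonneg, (ENNReal.ofReal_toReal hmtop).symm⟩
  obtain ⟨y, hy0, hy⟩ : ∃ y : ℝ, 0 ≤ y ∧ g = ENNReal.ofReal y :=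
    ⟨g.toReal, ENNReal.toReal_nonneg, (ENNReal.ofReal_toReal htop).symm⟩
  have hk := key (√(2 * x)) (Real.sqrt_nonneg _)
  rw [hx, hy, ← ENNReal.ofReal_mul (Real.sqrt_nonneg _), ← ENNReal.ofReal_add hy0 (by positivity),
    ENNReal.ofReal_le_ofReal_iff (by positivity)] at hk
  have hs := Real.sq_sqrt (show 0 ≤ 2 * x by positivity)
  set r := √(2 * x)
  have hr0 : 0 ≤ r := Real.sqrt_nonneg _
  have h1 : r ^ 3 ≤ 3 * y := by nlinarith
  have h2 : (r ^ 3) ^ 2 ≤ (3 * y) ^ 2 := pow_le_pow_left₀ (by positivity) h1 2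
  have h3 : (r ^ 3) ^ 2 = 8 * x ^ 3 := by rw [← pow_mul, mul_comm, pow_mul, hs]; ring
  rw [hx, hy, ← ENNReal.ofReal_pow hx0, ← ENNReal.ofReal_pow hy0,
    show (8 : ENNReal) = ENNReal.ofReal 8 by norm_num,
    show (9 : ENNReal) = ENNReal.ofReal 9 by norm_num, ← ENNReal.ofReal_mul (by norm_num),
    ← ENNReal.ofReal_mul (by norm_num)]
  exact ENNReal.ofReal_le_ofReal (by nlinarith)

open Set in
theorem volume_pow_three_le_of_snd_pos {S : Set (ℝ × ℝ)} (hS : MeasurableSet S)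
    (hpos : ∀ z ∈ S, 0 < z.2) (hfin : ∫⁻ z in S, ENNReal.ofReal z.2 ≠ ⊤) :
    16 * volume S ^ 3 ≤ 9 * ENNReal.ofReal Real.pi ^ 2 *
      ∫⁻ z in S, ∫⁻ w in S, ENNReal.ofReal |z.1 * w.2 - z.2 * w.1| := by
  set T : ℝ → Set ℝ := fun t ↦ {b | 0 < b ∧ (t * b, b) ∈ S} with hTdef
  have hTm : ∀ t, MeasurableSet (T t) := fun t ↦
    measurableSet_Ioi.inter (hS.preimage (by fun_prop : Measurable fun b : ℝ ↦ (t * b, b)))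
  set m : ℝ → ENNReal := fun t ↦ ∫⁻ b in T t, ENNReal.ofReal b with hm
  set g : ℝ → ENNReal := fun t ↦ ∫⁻ b in T t, ENNReal.ofReal (b ^ 2) with hg
  have hgm : Measurable g := by
    have hset : MeasurableSet {p : ℝ × ℝ | 0 < p.2 ∧ (p.1 * p.2, p.2) ∈ S} :=
      (measurableSet_lt measurable_const measurable_snd).inter
        (hS.preimage (by fun_prop : Measurable fun p : ℝ × ℝ ↦ (p.1 * p.2, p.2)))
    have : g = fun t ↦ ∫⁻ b, {p : ℝ × ℝ | 0 < p.2 ∧ (p.1 * p.2, p.2) ∈ S}.indicator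
        (fun p ↦ ENNReal.ofReal (p.2 ^ 2)) (t, b) := by
      ext t
      rw [hg]
      dsimp only
      rw [← lintegral_indicator (hTm t)]
      rfl
    rw [this]
    exact Measurable.lintegral_prod_right' (Measurable.indicator (by fun_prop) hset)
  have hslice : ∀ (t : ℝ) (h : ℝ → ENNReal), ∫⁻ b in Ioi (0 : ℝ),
      ENNReal.ofReal b * S.indicator (fun z ↦ h z.2) (t * b, b) =
      ∫⁻ b in T t, ENNReal.ofReal b * h b := by
    intro t h
    rw [← lintegral_indicator measurableSet_Ioi, ← lintegral_indicator (hTm t)]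
    refine lintegral_congr fun b ↦ ?_
    simp only [indicator_apply, hTdef, mem_Ioi]
    by_cases h1 : 0 < b <;> by_cases h2 : (t * b, b) ∈ S <;> simp [h1, h2]
  have hcov : ∀ F : ℝ × ℝ → ENNReal, Measurable F → ∫⁻ z in S, F z =
      ∫⁻ t : ℝ, ∫⁻ b in Ioi (0 : ℝ), ENNReal.ofReal b * S.indicator F (t * b, b) := by
    intro F hF
    rw [← setLIntegral_snd_pos_eq (hF.indicator hS), setLIntegral_indicator hS,
      inter_eq_left.2 (show S ⊆ {z | 0 < z.2} from hpos)]
  have hvol : volume S = ∫⁻ t, m t := by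
    rw [← setLIntegral_one, hcov _ measurable_const]
    refine lintegral_congr fun t ↦ ?_
    rw [hslice t (fun _ ↦ 1)]
    simp [hm]
  have hpush : ((volume.restrict S).withDensity fun z ↦ ENNReal.ofReal z.2).map
      (fun z ↦ z.1 / z.2) = volume.withDensity g := by
    ext B hB
    have hdiv : Measurable fun z : ℝ × ℝ ↦ z.1 / z.2 := by fun_prop
    rw [Measure.map_apply hdiv hB, withDensity_apply _ (hdiv hB), withDensity_apply _ hB,
      ← lintegral_indicator (hdiv hB),
      hcov _ (Measurable.indicator (by fun_prop) (hdiv hB)), ← lintegral_indicator hB]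
    refine lintegral_congr fun t ↦ ?_
    by_cases ht : t ∈ B
    · rw [indicator_of_mem ht, hg]
      dsimp only
      rw [← lintegral_indicator measurableSet_Ioi, ← lintegral_indicator (hTm t)]
      refine lintegral_congr fun b ↦ ?_
      by_cases h1 : 0 < b
      · by_cases h2 : (t * b, b) ∈ S <;>
          simp [hTdef, h1, h2, h1.ne', ht, sq, ENNReal.ofReal_mul h1.le]
      · simp [hTdef, h1]
    · rw [indicator_of_notMem ht]
      refine setLIntegral_eq_zero measurableSet_Ioi fun b hb ↦ ?_
      have hb : 0 < b := hb
      simp [hb.ne', ht]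
  have hgfin : ∫⁻ t, g t ≠ ⊤ := by
    have h := DFunLike.congr_fun hpush univ
    rw [Measure.map_apply (by fun_prop) .univ, preimage_univ, withDensity_apply _ .univ,
      withDensity_apply _ .univ, Measure.restrict_univ, Measure.restrict_univ] at h
    rwa [← h]
  have hJ : ∫⁻ z in S, ∫⁻ w in S, ENNReal.ofReal |z.1 * w.2 - z.2 * w.1| =
      ∫⁻ s, ∫⁻ t, ENNReal.ofReal |s - t| ∂(volume.withDensity g) ∂(volume.withDensity g) := by
    have hdiv : Measurable fun z : ℝ × ℝ ↦ z.1 / z.2 := by fun_prop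
    have hd : Measurable fun z : ℝ × ℝ ↦ ENNReal.ofReal z.2 := by fun_prop
    have h2 : Measurable fun p : ℝ × ℝ ↦ ENNReal.ofReal |p.1 - p.2| := by fun_prop
    have hin : ∀ s : ℝ, ∫⁻ t, ENNReal.ofReal |s - t| ∂(volume.withDensity g) =
        ∫⁻ w in S, ENNReal.ofReal w.2 * ENNReal.ofReal |s - w.1 / w.2| := by
      intro s
      rw [← hpush, lintegral_map (by fun_prop) hdiv,
        lintegral_withDensity_eq_lintegral_mul _ hd (by fun_prop)]
      rfl
    have hmeas : Measurable fun s : ℝ ↦ ∫⁻ t, ENNReal.ofReal |s - t| ∂(volume.withDensity g) :=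
      h2.lintegral_prod_right'
    conv_rhs => rw [← congrArg (lintegral · _) hpush]
    rw [lintegral_map hmeas hdiv, lintegral_withDensity_eq_lintegral_mul _ hd
      (show Measurable fun z : ℝ × ℝ ↦ ∫⁻ t, ENNReal.ofReal |z.1 / z.2 - t| ∂(volume.withDensity g)
        from hmeas.comp hdiv)]
    refine setLIntegral_congr_fun hS fun z hz ↦ ?_
    simp only [Pi.mul_apply, hin]
    rw [← lintegral_const_mul _ (by fun_prop)]
    refine setLIntegral_congr_fun hS fun w hw ↦ ?_
    have hz0 := hpos z hz
    have hw0 := hpos w hw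
    rw [← ENNReal.ofReal_mul hw0.le, ← ENNReal.ofReal_mul hz0.le]
    congr 1
    rw [← abs_of_pos hw0, ← abs_mul, ← abs_of_pos hz0, ← abs_mul, abs_of_pos hw0, abs_of_pos hz0]
    congr 1
    field_simp
  have hmg : ∀ t, m t ≤ (9 / 8 : ENNReal) ^ (1 / 3 : ℝ) * g t ^ (2 / 3 : ℝ) := by
    intro t
    have h := setLIntegral_id_pow_three_le (hTm t) fun b hb ↦ hb.1
    have h' : m t ^ (3 : ℝ) ≤ (9 / 8) * g t ^ (2 : ℝ) := by
      rw [div_eq_mul_inv, mul_right_comm, ← div_eq_mul_inv,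
        ENNReal.le_div_iff_mul_le (by norm_num) (by norm_num), mul_comm]
      exact_mod_cast h
    calc m t = (m t ^ (3 : ℝ)) ^ (1 / 3 : ℝ) := by rw [← ENNReal.rpow_mul]; norm_num
      _ ≤ ((9 / 8) * g t ^ (2 : ℝ)) ^ (1 / 3 : ℝ) := by gcongr
      _ = _ := by
        rw [ENNReal.mul_rpow_of_nonneg _ _ (by norm_num), ← ENNReal.rpow_mul]
        norm_num
  have hA : 8 * volume S ^ 3 ≤ 9 * (∫⁻ t, g t ^ (2 / 3 : ℝ)) ^ 3 := by
    have h1 : volume S ≤ (9 / 8 : ENNReal) ^ (1 / 3 : ℝ) * ∫⁻ t, g t ^ (2 / 3 : ℝ) := by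
      rw [hvol, ← lintegral_const_mul _ (hgm.pow_const _)]
      exact lintegral_mono hmg
    calc 8 * volume S ^ 3
        ≤ 8 * ((9 / 8 : ENNReal) ^ (1 / 3 : ℝ) * ∫⁻ t, g t ^ (2 / 3 : ℝ)) ^ 3 := by gcongr
      _ = 8 * (9 / 8) * (∫⁻ t, g t ^ (2 / 3 : ℝ)) ^ 3 := by
        rw [mul_pow, ← ENNReal.rpow_natCast ((9 / 8 : ENNReal) ^ (1 / 3 : ℝ)), ← ENNReal.rpow_mul]
        norm_num [mul_assoc]
      _ = _ := by rw [ENNReal.mul_div_cancel (by norm_num) (by norm_num)]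
  calc 16 * volume S ^ 3 = 2 * (8 * volume S ^ 3) := by ring
    _ ≤ 2 * (9 * (ENNReal.ofReal Real.pi ^ 2 *
        ∫⁻ s, volume.withDensity g (Iic s) * volume.withDensity g (Ioi s))) := by
      gcongr 2 * ?_
      refine hA.trans ?_
      gcongr
      exact lintegral_rpow_two_thirds_le hgm hgfin
    _ = _ := by rw [hJ, lintegral_lintegral_abs_sub]; ring

open Set in
theorem volume_pow_three_le_of_snd_nonneg {S : Set (ℝ × ℝ)} (hS : MeasurableSet S)
    (hnonneg : ∀ z ∈ S, 0 ≤ z.2) (hfin : ∫⁻ z in S, ENNReal.ofReal z.2 ≠ ⊤) :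
    16 * volume S ^ 3 ≤ 9 * ENNReal.ofReal Real.pi ^ 2 *
      ∫⁻ z in S, ∫⁻ w in S, ENNReal.ofReal |z.1 * w.2 - z.2 * w.1| := by
  have hnull : volume {z : ℝ × ℝ | z.2 = 0} = 0 := by
    have : {z : ℝ × ℝ | z.2 = 0} = univ ×ˢ {0} := by ext; simp
    rw [this, Measure.volume_eq_prod, Measure.prod_prod]
    simp
  have hae : (S ∩ {z : ℝ × ℝ | 0 < z.2} : Set (ℝ × ℝ)) =ᵐ[volume] S := by
    have : ∀ᵐ z : ℝ × ℝ, z.2 ≠ 0 := by simpa [ae_iff] using hnull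
    filter_upwards [this] with z hz
    refine propext ⟨fun h ↦ h.1, fun h ↦ ⟨h, lt_of_le_of_ne (hnonneg z h) hz.symm⟩⟩
  have h := volume_pow_three_le_of_snd_pos
    (hS.inter (measurableSet_lt measurable_const measurable_snd)) (fun z hz ↦ hz.2)
    (by rwa [Measure.restrict_congr_set hae])
  rwa [Measure.restrict_congr_set hae, measure_congr hae] at h

open Set in
theorem convexHull_zero_unit_vectors :
    convexHull ℝ {((0, 0) : ℝ × ℝ), (1, 0), (0, 1)} =
      {z : ℝ × ℝ | 0 ≤ z.1 ∧ 0 ≤ z.2 ∧ z.1 + z.2 ≤ 1} := by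
  refine Subset.antisymm (convexHull_min ?_ ?_) ?_
  · rintro z (rfl | rfl | rfl) <;> norm_num
  · rintro z ⟨h1, h2, h3⟩ w ⟨k1, k2, k3⟩ a b ha hb hab
    refine ⟨?_, ?_, ?_⟩ <;> simp only [Prod.fst_add, Prod.snd_add, Prod.smul_fst, Prod.smul_snd,
      smul_eq_mul]
    · positivity
    · positivity
    · nlinarith
  · rintro ⟨a, b⟩ ⟨h1, h2, h3⟩
    simp only at h1 h2 h3
    have h := (convex_convexHull ℝ {((0, 0) : ℝ × ℝ), (1, 0), (0, 1)}).sum_mem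
      (t := Finset.univ) (w := ![1 - a - b, a, b]) (z := ![(0, 0), (1, 0), (0, 1)])
      (by
        intro i _
        fin_cases i <;> simp <;> linarith)
      (by simp [Fin.sum_univ_three]; ring)
      (by
        intro i _
        apply subset_convexHull
        fin_cases i <;> simp)
    simpa [Fin.sum_univ_three] using h

open Set in
theorem volume_convexHull_zero_unit_vectors :
    volume (convexHull ℝ {((0, 0) : ℝ × ℝ), (1, 0), (0, 1)}) = ENNReal.ofReal (1 / 2) := by
  rw [convexHull_zero_unit_vectors, Measure.volume_eq_prod, Measure.prod_apply (by measurability)]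
  have : ∀ a : ℝ, volume (Prod.mk a ⁻¹' {z : ℝ × ℝ | 0 ≤ z.1 ∧ 0 ≤ z.2 ∧ z.1 + z.2 ≤ 1}) =
      (Ioc (0 : ℝ) 1).indicator (fun a ↦ ENNReal.ofReal (1 - a)) a +
        ({0} : Set ℝ).indicator 1 a := by
    intro a
    have hIcc : 0 ≤ a →
        Prod.mk a ⁻¹' {z : ℝ × ℝ | 0 ≤ z.1 ∧ 0 ≤ z.2 ∧ z.1 + z.2 ≤ 1} = Icc 0 (1 - a) := by
      intro ha
      ext b
      simp [ha, le_sub_iff_add_le']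
    rcases lt_trichotomy a 0 with ha | rfl | ha
    · have : Prod.mk a ⁻¹' {z : ℝ × ℝ | 0 ≤ z.1 ∧ 0 ≤ z.2 ∧ z.1 + z.2 ≤ 1} = ∅ := by
        ext b
        simp [ha.not_ge]
      simp [this, ha.not_gt, ha.ne]
    · simp [hIcc le_rfl]
    · rw [hIcc ha.le, Real.volume_Icc, sub_zero]
      by_cases h1 : a ≤ 1
      · simp [ha, h1, ha.ne']
      · simp [h1, ha.ne', (not_le.1 h1).le]
  simp_rw [this]
  rw [lintegral_add_right _ (measurable_one.indicator (measurableSet_singleton 0)),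
    lintegral_indicator measurableSet_Ioc, lintegral_indicator_one (measurableSet_singleton 0),
    Real.volume_singleton, add_zero, ← ofReal_integral_eq_lintegral_ofReal
      (Continuous.integrableOn_Ioc (by fun_prop))
      ((ae_restrict_iff' measurableSet_Ioc).2 <| Filter.Eventually.of_forall fun b hb ↦
        sub_nonneg.2 hb.2), ← intervalIntegral.integral_of_le zero_le_one]
  congr 1
  rw [intervalIntegral.integral_sub (by simp) (by simp)]
  norm_num

open Set in
theorem volume_convexHull_zero_pair (p q : ℝ × ℝ) :
    volume (convexHull ℝ {0, p, q}) = ENNReal.ofReal (|p.1 * q.2 - p.2 * q.1| / 2) := by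
  set L := Matrix.toLin (Module.Basis.finTwoProd ℝ) (Module.Basis.finTwoProd ℝ)
    !![p.1, q.1; p.2, q.2] with hL
  have himg : L '' {((0, 0) : ℝ × ℝ), (1, 0), (0, 1)} = {0, p, q} := by
    simp [image_insert_eq, hL, Matrix.toLin_finTwoProd_apply, Prod.zero_eq_mk]
  rw [← himg, ← LinearMap.image_convexHull, Measure.addHaar_image_linearMap,
    volume_convexHull_zero_unit_vectors, hL, LinearMap.det_toLin, Matrix.det_fin_two_of,
    ← ENNReal.ofReal_mul (abs_nonneg _)]
  ring_nf

theorem exists_measurePreserving_coordinates (x u : EuclideanSpace ℝ (Fin 2)) (hu : ‖u‖ = 1) :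
    ∃ e : EuclideanSpace ℝ (Fin 2) ≃ᵐ ℝ × ℝ, MeasurePreserving e ∧ Continuous e ∧ e x = 0 ∧
      (∀ s, e '' convexHull ℝ s = convexHull ℝ (e '' s)) ∧ ∀ v, (e v).2 = inner ℝ u (v - x) := by
  obtain ⟨b, hb⟩ := Orthonormal.exists_orthonormalBasis_extension_of_card_eq
    (𝕜 := ℝ) (E := EuclideanSpace ℝ (Fin 2)) (ι := Fin 2) (by simp) (v := fun _ ↦ u) (s := {1})
    (by
      refine ⟨fun i ↦ by simpa using hu, fun i j hij ↦ ?_⟩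
      exact absurd (Subsingleton.elim i j) hij)
  have hb1 : b 1 = u := hb 1 rfl
  let e : EuclideanSpace ℝ (Fin 2) ≃ᵐ ℝ × ℝ := (MeasurableEquiv.subRight x).trans
    (b.measurableEquiv.trans ((MeasurableEquiv.toLp 2 (Fin 2 → ℝ)).symm.trans
      (MeasurableEquiv.finTwoArrow)))
  have he : ∀ v, e v = (b.repr (v - x) 0, b.repr (v - x) 1) := fun v ↦ rfl
  refine ⟨e, ?_, ?_, ?_, ?_, ?_⟩
  · exact ((volume_preserving_finTwoArrow ℝ).comp (PiLp.volume_preserving_ofLp (Fin 2))).comp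
      (b.measurePreserving_repr.comp (measurePreserving_sub_right volume x))
  · simp_rw [funext he]
    fun_prop
  · simp [he]
  · intro s
    let f : EuclideanSpace ℝ (Fin 2) →ᵃ[ℝ] ℝ × ℝ :=
      { toFun := e
        linear :=
          { toFun := fun v ↦ (b.repr v 0, b.repr v 1)
            map_add' := fun v w ↦ by simp
            map_smul' := fun c v ↦ by simp }
        map_vadd' := fun p v ↦ by simp [he, add_sub_assoc] }
    exact f.image_convexHull s
  · intro v
    rw [he, ← hb1, ← b.repr_apply_apply]

open Set in
theorem exists_unit_inner_nonneg_of_mem_frontier {E : Type*} [NormedAddCommGroup E]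
    [InnerProductSpace ℝ E] [CompleteSpace E] {K : Set E} (hconv : Convex ℝ K)
    (hne : (interior K).Nonempty) {x : E} (hx : x ∈ frontier K) :
    ∃ u : E, ‖u‖ = 1 ∧ ∀ v ∈ K, 0 ≤ inner ℝ u (v - x) := by
  obtain ⟨f, hf⟩ := geometric_hahn_banach_open_point hconv.interior isOpen_interior hx.2
  set w := (InnerProductSpace.toDual ℝ E).symm f with hw
  have hfw : ∀ v, f v = inner ℝ w v := fun v ↦ by simp [hw]
  have hle : ∀ v ∈ K, f v ≤ f x := by
    have hcl : closure (interior K) ⊆ {v | f v ≤ f x} :=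
      closure_minimal (fun v hv ↦ (hf v hv).le) (isClosed_le f.continuous continuous_const)
    rw [hconv.closure_interior_eq_closure_of_nonempty_interior hne] at hcl
    exact fun v hv ↦ hcl (subset_closure hv)
  have hw0 : w ≠ 0 := by
    intro h0
    obtain ⟨v, hv⟩ := hne
    have := hf v hv
    simp [hfw, h0] at this
  refine ⟨-(‖w‖⁻¹ • w), ?_, fun v hv ↦ ?_⟩
  · rw [norm_neg, norm_smul, norm_inv, norm_norm, inv_mul_cancel₀ (norm_ne_zero_iff.2 hw0)]
  · have h := hle v hv
    rw [hfw, hfw] at h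
    rw [inner_neg_left, inner_smul_left, inner_sub_right, ← mul_neg]
    exact mul_nonneg (by simp) (by linarith)

/-- For a planar convex body `K` and a boundary point `x` of `K`, the expected
area of the triangle spanned by `x` and two independent uniformly random points
of `K` is at least `8/(9π²)` times the area of `K`. -/
theorem expected_triangle_area_with_boundary_point
    (K : Set (EuclideanSpace ℝ (Fin 2))) (hK : IsConvexBody K)
    (x : EuclideanSpace ℝ (Fin 2)) (hx : x ∈ frontier K) :
    (⨍ p : EuclideanSpace ℝ (Fin 2) × EuclideanSpace ℝ (Fin 2) in K ×ˢ K,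
        (volume (convexHull ℝ {x, p.1, p.2})).toReal) / (volume K).toReal ≥
      8 / (9 * Real.pi ^ 2) := by
  obtain ⟨hcpt, hconv, hne⟩ := hK
  obtain ⟨u, hu, hpos⟩ := exists_unit_inner_nonneg_of_mem_frontier hconv hne hx
  obtain ⟨e, he, hec, hex, hehull, hesnd⟩ := exists_measurePreserving_coordinates x u hu
  have harea : ∀ p q, (volume (convexHull ℝ {x, p, q})).toReal =
      |(e p).1 * (e q).2 - (e p).2 * (e q).1| / 2 := by
    intro p q
    have h1 : volume (convexHull ℝ {x, p, q}) = volume (e '' convexHull ℝ {x, p, q}) := by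
      rw [← he.measure_preimage_equiv, e.injective.preimage_image]
    rw [h1, hehull, Set.image_insert_eq, Set.image_pair, hex, volume_convexHull_zero_pair,
      ENNReal.toReal_ofReal (by positivity)]
  simp_rw [harea]
  set f : EuclideanSpace ℝ (Fin 2) × EuclideanSpace ℝ (Fin 2) → ℝ := fun p ↦
    |(e p.1).1 * (e p.2).2 - (e p.1).2 * (e p.2).1| / 2 with hf
  have hfc : Continuous f := by fun_prop
  have hint : IntegrableOn f (K ×ˢ K) := hfc.continuousOn.integrableOn_compact (hcpt.prod hcpt)
  have hf0 : ∀ p, 0 ≤ f p := fun p ↦ by positivity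
  have hKm := hcpt.measurableSet
  have hSc : IsCompact (e '' K) := hcpt.image hec
  have hvol : volume (e '' K) = volume K := by
    rw [← he.measure_preimage_equiv, e.injective.preimage_image]
  have hJ : ∫⁻ z in e '' K, ∫⁻ w in e '' K, ENNReal.ofReal |z.1 * w.2 - z.2 * w.1| =
      ENNReal.ofReal (2 * ∫ p in K ×ˢ K, f p) := by
    have hset : ∀ F : ℝ × ℝ → ENNReal, ∫⁻ z in e '' K, F z = ∫⁻ v in K, F (e v) := by
      intro F
      rw [← he.setLIntegral_comp_preimage_emb e.measurableEmbedding, e.injective.preimage_image]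
    simp_rw [hset]
    rw [← integral_const_mul, ofReal_integral_eq_lintegral_ofReal (hint.const_mul 2)
      (Filter.Eventually.of_forall fun p ↦ by have := hf0 p; positivity), Measure.volume_eq_prod,
      ← Measure.prod_restrict, lintegral_prod _ (by fun_prop)]
    simp [hf, mul_div_cancel₀]
  have hmain := volume_pow_three_le_of_snd_nonneg hSc.measurableSet
    (by
      rintro _ ⟨v, hv, rfl⟩
      rw [hesnd]
      exact hpos v hv)
    ((continuous_snd.continuousOn.integrableOn_compact hSc).lintegral_lt_top.ne)
  have hV : 0 < (volume K).toReal :=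
    ENNReal.toReal_pos (Measure.measure_pos_of_nonempty_interior _ hne).ne'
      hcpt.measure_lt_top.ne
  have hI : 0 ≤ ∫ p in K ×ˢ K, f p := integral_nonneg hf0
  rw [hJ, hvol, ← ENNReal.ofReal_toReal hcpt.measure_lt_top.ne, ← ENNReal.ofReal_pow hV.le,
    ← ENNReal.ofReal_pow Real.pi_pos.le, show (16 : ENNReal) = ENNReal.ofReal 16 by norm_num,
    show (9 : ENNReal) = ENNReal.ofReal 9 by norm_num, ← ENNReal.ofReal_mul (by norm_num),
    ← ENNReal.ofReal_mul (by norm_num), ← ENNReal.ofReal_mul (by positivity),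
    ENNReal.ofReal_le_ofReal_iff (by positivity)] at hmain
  rw [setAverage_eq, measureReal_def, Measure.volume_eq_prod, Measure.prod_prod,
    ENNReal.toReal_mul, ← Measure.volume_eq_prod, smul_eq_mul, ge_iff_le,
    div_le_div_iff₀ (by positivity) hV]
  set V := (volume K).toReal
  set I := ∫ p in K ×ˢ K, f p
  rw [mul_assoc, inv_mul_eq_div, le_div_iff₀ (by positivity)]
  nlinarith
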